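/- arXiv:2501.13712 — 2 statements merged into one kernel-verified Lean document; each statement's English description precedes it below -/
import Mathlib

section
/- For every LTL_f formula ρ, every trace T of length d, and every time index t, the loss is right-continuous in the smoothing factor at zero: L(ρ,T,t,γ) tends to L(ρ,T,t,0) as γ tends to 0 from the right. -/
/-- LTL_f formulas over real-valued traces. Atoms compare state components
indexed by natural numbers. -/
inductive Formula : Type where
  | leq : ℕ → ℕ → Formula          -- φ₁ ≤ φ₂
  | lt : ℕ → ℕ → Formula           -- φ₁ < φ₂
  | eq : ℕ → ℕ → Formula           -- φ₁ = φ₂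
  | neq : ℕ → ℕ → Formula          -- φ₁ ≠ φ₂
  | conj : Formula → Formula → Formula
  | disj : Formula → Formula → Formula
  | snext : Formula → Formula      -- 𝒩 (Strong Next)
  | wnext : Formula → Formula      -- 𝒳 (Weak Next)
  | always : Formula → Formula     -- □
  | eventually : Formula → Formula -- ◇
  | wuntil : Formula → Formula → Formula   -- 𝒰 (Weak Until)
  | srelease : Formula → Formula → Formula -- ℛ (Strong Release)

/-- Smooth maximum: `max γ a b`. -/
noncomputable def smax (γ a b : ℝ) : ℝ :=
  if γ ≤ 0 then max a b else γ * Real.log (Real.exp (a / γ) + Real.exp (b / γ))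

/-- Smooth minimum: `min γ a b`. -/
noncomputable def smin (γ a b : ℝ) : ℝ :=
  if γ ≤ 0 then min a b else -γ * Real.log (Real.exp (-a / γ) + Real.exp (-b / γ))

/-- Smooth Gaussian: `Gaussian γ a`. -/
noncomputable def sgauss (γ a : ℝ) : ℝ :=
  if γ ≤ 0 then (if a = 0 then 1 else 0) else Real.exp (-(a ^ 2) / (2 * γ ^ 2))

/-- A weight on formulas, used as a termination measure for the recursion
defining the loss (the clauses for `<` and `=` recurse into the clauses
for `≤` and `≠` at the same time step). -/
def Formula.weight : Formula → ℕ
  | .leq _ _ => 1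
  | .neq _ _ => 1
  | .lt _ _ => 2
  | .eq _ _ => 2
  | .conj ρ₁ ρ₂ => ρ₁.weight + ρ₂.weight + 1
  | .disj ρ₁ ρ₂ => ρ₁.weight + ρ₂.weight + 1
  | .snext ρ => ρ.weight + 1
  | .wnext ρ => ρ.weight + 1
  | .always ρ => ρ.weight + 1
  | .eventually ρ => ρ.weight + 1
  | .wuntil ρ₁ ρ₂ => ρ₁.weight + ρ₂.weight + 1
  | .srelease ρ₁ ρ₂ => ρ₁.weight + ρ₂.weight + 1


/-- The loss function L(ρ,T,t,γ) over a trace of length `d`. -/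
noncomputable def L (d : ℕ) (T : ℕ → ℕ → ℝ) (γ : ℝ) : Formula → ℕ → ℝ
  | ρ, t =>
    if t ≥ d then 1
    else
      match ρ with
      | .leq a b => smax γ (T t a - T t b) 0
      | .neq a b => sgauss γ (T t a - T t b)
      | .lt a b => smax γ (L d T γ (.leq a b) t) (L d T γ (.neq a b) t)
      | .eq a b => smax γ (L d T γ (.leq a b) t) (L d T γ (.leq b a) t)
      | .conj ρ₁ ρ₂ => smax γ (L d T γ ρ₁ t) (L d T γ ρ₂ t)
      | .disj ρ₁ ρ₂ => smin γ (L d T γ ρ₁ t) (L d T γ ρ₂ t)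
      | .snext ρ' => L d T γ ρ' (t+1)
      | .wnext ρ' => if t = d - 1 then 0 else L d T γ ρ' (t+1)
      | .always ρ' =>
          smax γ (L d T γ ρ' t)
            (if t = d - 1 then 0 else L d T γ (.always ρ') (t+1))
      | .eventually ρ' => smin γ (L d T γ ρ' t) (L d T γ (.eventually ρ') (t+1))
      | .wuntil ρ₁ ρ₂ =>
          smin γ (L d T γ ρ₂ t)
            (smax γ (L d T γ ρ₁ t)
              (if t = d - 1 then 0 else L d T γ (.wuntil ρ₁ ρ₂) (t+1)))
      | .srelease ρ₁ ρ₂ =>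
          smin γ (smax γ (L d T γ ρ₁ t) (L d T γ ρ₂ t))
            (smax γ (L d T γ ρ₂ t) (L d T γ (.srelease ρ₁ ρ₂) (t+1)))
termination_by ρ t => (d - t, ρ.weight)
decreasing_by all_goals
  (first
    | exact Prod.Lex.left _ _ (by omega)
    | exact Prod.Lex.right _ (by simp [Formula.weight] <;> omega))

open Filter Topology

lemma smax_zero (a b : ℝ) : smax 0 a b = max a b := if_pos le_rfl

lemma smin_eq_neg_smax_neg (γ a b : ℝ) : smin γ a b = -smax γ (-a) (-b) := by
  unfold smin smax
  split_ifs
  · rw [max_neg_neg, neg_neg]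
  · ring

lemma max_le_smax {γ : ℝ} (hγ : 0 < γ) (a b : ℝ) : max a b ≤ smax γ a b := by
  rw [smax, if_neg hγ.not_ge, ← div_le_iff₀' hγ,
    Real.le_log_iff_exp_le (by positivity), ← max_div_div_right hγ.le, Real.exp_monotone.map_max]
  exact max_le_add_of_nonneg (Real.exp_pos _).le (Real.exp_pos _).le

lemma smax_le_max_add {γ : ℝ} (hγ : 0 < γ) (a b : ℝ) :
    smax γ a b ≤ max a b + γ * Real.log 2 := by
  have hlog : Real.log (Real.exp (a / γ) + Real.exp (b / γ)) ≤ max a b / γ + Real.log 2 := by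
    rw [Real.log_le_iff_le_exp (by positivity), Real.exp_add, Real.exp_log two_pos, mul_two]
    gcongr
    · exact le_max_left a b
    · exact le_max_right a b
  calc smax γ a b = γ * Real.log (Real.exp (a / γ) + Real.exp (b / γ)) := if_neg hγ.not_ge
    _ ≤ γ * (max a b / γ + Real.log 2) := by gcongr
    _ = max a b + γ * Real.log 2 := by field_simp

lemma tendsto_smax {f g : ℝ → ℝ} {a b : ℝ} (hf : Tendsto f (𝓝[>] 0) (𝓝 a))
    (hg : Tendsto g (𝓝[>] 0) (𝓝 b)) :
    Tendsto (fun γ => smax γ (f γ) (g γ)) (𝓝[>] 0) (𝓝 (smax 0 a b)) := by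
  rw [smax_zero]
  have hlin : Tendsto (fun γ : ℝ => γ * Real.log 2) (𝓝[>] 0) (𝓝 0) := by
    have h : Tendsto (fun γ : ℝ => γ) (𝓝[>] 0) (𝓝 0) := nhdsWithin_le_nhds
    simpa using h.mul_const (Real.log 2)
  refine tendsto_of_tendsto_of_tendsto_of_le_of_le' (hf.max hg)
    (by simpa using (hf.max hg).add hlin) ?_ ?_
  · filter_upwards [self_mem_nhdsWithin] with γ hγ using max_le_smax hγ _ _
  · filter_upwards [self_mem_nhdsWithin] with γ hγ using smax_le_max_add hγ _ _

lemma tendsto_smin {f g : ℝ → ℝ} {a b : ℝ} (hf : Tendsto f (𝓝[>] 0) (𝓝 a))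
    (hg : Tendsto g (𝓝[>] 0) (𝓝 b)) :
    Tendsto (fun γ => smin γ (f γ) (g γ)) (𝓝[>] 0) (𝓝 (smin 0 a b)) := by
  simp only [smin_eq_neg_smax_neg]
  exact (tendsto_smax hf.neg hg.neg).neg

lemma tendsto_sgauss (a : ℝ) : Tendsto (fun γ => sgauss γ a) (𝓝[>] 0) (𝓝 (sgauss 0 a)) := by
  have hpos : (fun γ : ℝ => Real.exp (-(a ^ 2) / 2 * (γ⁻¹) ^ 2)) =ᶠ[𝓝[>] 0]
      fun γ => sgauss γ a := by
    filter_upwards [self_mem_nhdsWithin] with γ hγ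
    rw [sgauss, if_neg (not_le.mpr hγ)]
    congr 1
    field_simp
  refine Tendsto.congr' hpos ?_
  rw [sgauss, if_pos le_rfl]
  split_ifs with ha
  · simp [ha]
  · have hneg : -(a ^ 2) / 2 < 0 := by
      have : 0 < a ^ 2 := by positivity
      linarith
    exact Real.tendsto_exp_atBot.comp <| Tendsto.const_mul_atTop_of_neg hneg <|
      (tendsto_pow_atTop two_ne_zero).comp tendsto_inv_nhdsGT_zero

/-- the loss is right-continuous in the smoothing factor at zero. -/
theorem loss_rightContinuous_at_zero (ρ : Formula) (d : ℕ) (T : ℕ → ℕ → ℝ)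
    (t : ℕ) :
    Tendsto (fun γ : ℝ => L d T γ ρ t) (𝓝[>] 0) (𝓝 (L d T 0 ρ t)) := by
  induction hn : d - t generalizing t ρ with
  | zero =>
    have ht : t ≥ d := by omega
    unfold L
    simp only [ht, if_true]
    exact tendsto_const_nhds
  | succ n ih =>
    have ht : ¬ t ≥ d := by omega
    have next (σ : Formula) := ih σ (t + 1) (by omega)
    have next_or_zero (σ : Formula) :
        Tendsto (fun γ => if t = d - 1 then 0 else L d T γ σ (t + 1)) (𝓝[>] 0)
          (𝓝 (if t = d - 1 then 0 else L d T 0 σ (t + 1))) := by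
      split_ifs
      · exact tendsto_const_nhds
      · exact next σ
    have leq (a b : ℕ) : Tendsto (fun γ => L d T γ (.leq a b) t) (𝓝[>] 0)
        (𝓝 (L d T 0 (.leq a b) t)) := by
      unfold L
      simp only [ht, if_false]
      exact tendsto_smax tendsto_const_nhds tendsto_const_nhds
    have neq (a b : ℕ) : Tendsto (fun γ => L d T γ (.neq a b) t) (𝓝[>] 0)
        (𝓝 (L d T 0 (.neq a b) t)) := by
      unfold L
      simp only [ht, if_false]
      exact tendsto_sgauss _
    induction ρ with
    | leq a b => exact leq a b
    | neq a b => exact neq a b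
    | lt a b =>
      unfold L
      simp only [ht, if_false]
      exact tendsto_smax (leq a b) (neq a b)
    | eq a b =>
      unfold L
      simp only [ht, if_false]
      exact tendsto_smax (leq a b) (leq b a)
    | conj _ _ ih₁ ih₂ =>
      unfold L
      simp only [ht, if_false]
      exact tendsto_smax ih₁ ih₂
    | disj _ _ ih₁ ih₂ =>
      unfold L
      simp only [ht, if_false]
      exact tendsto_smin ih₁ ih₂
    | snext σ =>
      unfold L
      simp only [ht, if_false]
      exact next σ
    | wnext σ =>
      unfold L
      simp only [ht, if_false]
      exact next_or_zero σ
    | always _ ihσ =>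
      unfold L
      simp only [ht, if_false]
      exact tendsto_smax ihσ (next_or_zero _)
    | eventually _ ihσ =>
      unfold L
      simp only [ht, if_false]
      exact tendsto_smin ihσ (next _)
    | wuntil _ _ ih₁ ih₂ =>
      unfold L
      simp only [ht, if_false]
      exact tendsto_smin ih₂ (tendsto_smax ih₁ (next_or_zero _))
    | srelease _ _ ih₁ ih₂ =>
      unfold L
      simp only [ht, if_false]
      exact tendsto_smin (tendsto_smax ih₁ ih₂) (tendsto_smax ih₂ (next _))
end

section
/- (Correctness of syntactic negation.) For every LTL_f formula ρ, every trace T of length d, and every time index t with t < d: eval(Not(ρ),T,t) = ¬eval(ρ,T,t). -/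
/-- Boolean evaluation of an LTL_f formula over a trace of length `d`
(states `T 0, …, T (d-1)`, each a function ℕ → ℝ), from time `t`. -/
noncomputable def eval (d : ℕ) (T : ℕ → ℕ → ℝ) : Formula → ℕ → Bool
  | ρ, t =>
    if t ≥ d then false
    else
      match ρ with
      | .leq a b => decide (T t a ≤ T t b)
      | .lt a b => decide (T t a < T t b)
      | .eq a b => decide (T t a = T t b)
      | .neq a b => decide (T t a ≠ T t b)
      | .conj ρ₁ ρ₂ => eval d T ρ₁ t && eval d T ρ₂ t
      | .disj ρ₁ ρ₂ => eval d T ρ₁ t || eval d T ρ₂ t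
      | .snext ρ' => eval d T ρ' (t+1)
      | .wnext ρ' => if t = d - 1 then true else eval d T ρ' (t+1)
      | .always ρ' =>
          eval d T ρ' t && (if t = d - 1 then true else eval d T (.always ρ') (t+1))
      | .eventually ρ' => eval d T ρ' t || eval d T (.eventually ρ') (t+1)
      | .wuntil ρ₁ ρ₂ =>
          eval d T ρ₂ t || (eval d T ρ₁ t &&
            (if t = d - 1 then true else eval d T (.wuntil ρ₁ ρ₂) (t+1)))
      | .srelease ρ₁ ρ₂ =>
          (eval d T ρ₁ t && eval d T ρ₂ t) ||
            (eval d T ρ₂ t && eval d T (.srelease ρ₁ ρ₂) (t+1))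
termination_by ρ t => (d - t, sizeOf ρ)

/-- Syntactic negation Not(ρ), by structural recursion. -/
def Formula.negate : Formula → Formula
  | .leq a b => .lt b a
  | .lt a b => .leq b a
  | .eq a b => .neq a b
  | .neq a b => .eq a b
  | .conj ρ₁ ρ₂ => .disj ρ₁.negate ρ₂.negate
  | .disj ρ₁ ρ₂ => .conj ρ₁.negate ρ₂.negate
  | .snext ρ => .wnext ρ.negate
  | .wnext ρ => .snext ρ.negate
  | .always ρ => .eventually ρ.negate
  | .eventually ρ => .always ρ.negate
  | .wuntil ρ₁ ρ₂ => .srelease ρ₁.negate ρ₂.negate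
  | .srelease ρ₁ ρ₂ => .wuntil ρ₁.negate ρ₂.negate

theorem eval_of_le (ρ : Formula) {d : ℕ} (T : ℕ → ℕ → ℝ) {t : ℕ} (h : d ≤ t) :
    eval d T ρ t = false := by
  rw [eval.eq_def]
  simp [h]

/-- Backward induction on the indices of a sequence of length `d`. -/
theorem backward_induction {d : ℕ} {P : ℕ → Prop}
    (step : ∀ t < d, (t + 1 < d → P (t + 1)) → P t) : ∀ t < d, P t := by
  intro t ht
  induction h : d - t generalizing t with
  | zero => omega
  | succ n ih => exact step t ht fun h' => ih (t + 1) h' (by omega)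

/-- Correctness of syntactic negation. -/
theorem eval_negate (ρ : Formula) (d : ℕ) (T : ℕ → ℕ → ℝ) (t : ℕ) (ht : t < d) :
    eval d T ρ.negate t = !(eval d T ρ t) := by
  induction ρ generalizing t with
  | leq a b | lt a b | eq a b | neq a b =>
    rw [Formula.negate, eval, eval]
    simp [not_le.mpr ht, ← not_lt]
  | conj ρ₁ ρ₂ ih₁ ih₂ | disj ρ₁ ρ₂ ih₁ ih₂ =>
    rw [Formula.negate, eval, eval]
    simp [not_le.mpr ht, ih₁ t ht, ih₂ t ht]
  | snext ρ ih | wnext ρ ih =>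
    rw [Formula.negate, eval, eval]
    by_cases hl : t = d - 1
    · simp [not_le.mpr ht, if_pos hl, eval_of_le _ T (show d ≤ t + 1 by omega)]
    · simp [not_le.mpr ht, if_neg hl, ih (t + 1) (by omega)]
  | always ρ ih | eventually ρ ih =>
    revert t
    refine backward_induction fun t ht next => ?_
    rw [Formula.negate] at next ⊢
    conv_lhs => rw [eval]
    conv_rhs => rw [eval]
    by_cases hl : t = d - 1
    · simp [not_le.mpr ht, if_pos hl, eval_of_le _ T (show d ≤ t + 1 by omega), ih t ht]
    · simp [not_le.mpr ht, if_neg hl, next (by omega), ih t ht]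
  | wuntil ρ₁ ρ₂ ih₁ ih₂ | srelease ρ₁ ρ₂ ih₁ ih₂ =>
    revert t
    refine backward_induction fun t ht next => ?_
    rw [Formula.negate] at next ⊢
    conv_lhs => rw [eval]
    conv_rhs => rw [eval]
    by_cases hl : t = d - 1
    · simp only [ge_iff_le, not_le.mpr ht, if_false, if_pos hl,
        eval_of_le _ T (show d ≤ t + 1 by omega), ih₁ t ht, ih₂ t ht]
      cases eval d T ρ₁ t <;> cases eval d T ρ₂ t <;> rfl
    · simp only [ge_iff_le, not_le.mpr ht, if_false, if_neg hl, next (by omega),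
        ih₁ t ht, ih₂ t ht]
      cases eval d T ρ₁ t <;> cases eval d T ρ₂ t <;> simp
end
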